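/- Suppose the line ℓ meets the circle C in two distinct points a and b, and let p, q, r, s ∈ ℓ be points not on C with cr(a,b;p,q) = cr(a,b;s,r). Then I_s ∘ I_r ∘ I_q ∘ I_p is the identity map of C; in particular, for every x ∈ C there is an inscribed quadrilateral starting at x whose sides pass consecutively through p, q, r, s. -/

import Mathlib

open Metric

/-- The Euclidean plane. -/
abbrev E2 : Type := EuclideanSpace ℝ (Fin 2)

/-- `I` restricts on the circle `sphere o ρ` to the chord map through `p`:
for every `x` on the circle, `I x` is the point of the circle on the line through `x` and `p`
such that every point of the circle on that line equals `x` or `I x`. -/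
def ChordMap (o : E2) (ρ : ℝ) (p : E2) (I : E2 → E2) : Prop :=
  ∀ x ∈ sphere o ρ, I x ∈ sphere o ρ ∧
    I x ∈ affineSpan ℝ ({x, p} : Set E2) ∧
    ∀ z ∈ sphere o ρ, z ∈ affineSpan ℝ ({x, p} : Set E2) → z = x ∨ z = I x

/-- The cross-ratio of four collinear points, in terms of their coordinates with respect to
an affine parametrization of their common line. -/
noncomputable def crossRatio (ta tb tc td : ℝ) : ℝ :=
  ((ta - tc) / (tb - tc)) * ((tb - td) / (ta - td))

/-- The coordinate of `x` along the direction `b - a`, normalized so that `a` has coordinate `0`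
and `b` has coordinate `1`. -/
noncomputable def alongCoord (a b x : E2) : ℝ :=
  ((b 0 - a 0) * (x 0 - a 0) + (b 1 - a 1) * (x 1 - a 1)) / ((b 0 - a 0) ^ 2 + (b 1 - a 1) ^ 2)

/-- The coordinate of `x` orthogonal to the direction `b - a`, vanishing on the line `ab`. -/
noncomputable def acrossCoord (a b x : E2) : ℝ :=
  ((b 0 - a 0) * (x 1 - a 1) - (b 1 - a 1) * (x 0 - a 0)) / ((b 0 - a 0) ^ 2 + (b 1 - a 1) ^ 2)

/-- A projective parameter on a circle with center `o` through `a` and `b`, sending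
`a` to `0` and `b` to `∞`. -/
noncomputable def secantParam (o a b x : E2) : ℝ :=
  alongCoord a b x / acrossCoord a b x + 2 * acrossCoord a b o

lemma sq_add_sq_ne_zero_of_ne {a b : E2} (hab : a ≠ b) :
    (b 0 - a 0) ^ 2 + (b 1 - a 1) ^ 2 ≠ 0 := by
  intro h
  apply hab
  ext i
  fin_cases i
  · simp only [Fin.zero_eta]
    nlinarith [sq_nonneg (b 0 - a 0), sq_nonneg (b 1 - a 1)]
  · simp only [Fin.mk_one]
    nlinarith [sq_nonneg (b 0 - a 0), sq_nonneg (b 1 - a 1)]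

lemma alongCoord_lineMap (a b x p : E2) (c : ℝ) :
    alongCoord a b (AffineMap.lineMap x p c) =
      alongCoord a b x + c * (alongCoord a b p - alongCoord a b x) := by
  simp only [alongCoord, AffineMap.lineMap_apply, vsub_eq_sub, vadd_eq_add, PiLp.add_apply,
    PiLp.smul_apply, PiLp.sub_apply, smul_eq_mul]
  ring

lemma acrossCoord_lineMap (a b x p : E2) (c : ℝ) :
    acrossCoord a b (AffineMap.lineMap x p c) =
      acrossCoord a b x + c * (acrossCoord a b p - acrossCoord a b x) := by
  simp only [acrossCoord, AffineMap.lineMap_apply, vsub_eq_sub, vadd_eq_add, PiLp.add_apply,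
    PiLp.smul_apply, PiLp.sub_apply, smul_eq_mul]
  ring

lemma alongCoord_left (a b : E2) : alongCoord a b a = 0 := by simp [alongCoord]

lemma acrossCoord_left (a b : E2) : acrossCoord a b a = 0 := by simp [acrossCoord]

lemma alongCoord_right {a b : E2} (hab : a ≠ b) : alongCoord a b b = 1 := by
  have hD := sq_add_sq_ne_zero_of_ne hab
  rw [alongCoord, div_eq_one_iff_eq hD]
  ring

lemma acrossCoord_right (a b : E2) : acrossCoord a b b = 0 := by
  rw [acrossCoord, mul_comm, sub_self, zero_div]

lemma coord_zero_eq {a b : E2} (hab : a ≠ b) (x : E2) :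
    x 0 = a 0 + (b 0 - a 0) * alongCoord a b x - (b 1 - a 1) * acrossCoord a b x := by
  have hD := sq_add_sq_ne_zero_of_ne hab
  rw [alongCoord, acrossCoord]
  field_simp
  ring

lemma coord_one_eq {a b : E2} (hab : a ≠ b) (x : E2) :
    x 1 = a 1 + (b 1 - a 1) * alongCoord a b x + (b 0 - a 0) * acrossCoord a b x := by
  have hD := sq_add_sq_ne_zero_of_ne hab
  rw [alongCoord, acrossCoord]
  field_simp
  ring

lemma eq_of_coord_eq {a b x y : E2} (hab : a ≠ b) (h₁ : alongCoord a b x = alongCoord a b y)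
    (h₂ : acrossCoord a b x = acrossCoord a b y) : x = y := by
  ext i
  fin_cases i
  · simp only [Fin.zero_eta]
    rw [coord_zero_eq hab x, coord_zero_eq hab y, h₁, h₂]
  · simp only [Fin.mk_one]
    rw [coord_one_eq hab x, coord_one_eq hab y, h₁, h₂]

lemma mem_sphere_iff_sq {o x : E2} {ρ : ℝ} (hρ : 0 < ρ) :
    x ∈ sphere o ρ ↔ (x 0 - o 0) ^ 2 + (x 1 - o 1) ^ 2 = ρ ^ 2 := by
  rw [mem_sphere, EuclideanSpace.dist_eq, Real.sqrt_eq_iff_eq_sq (by positivity) hρ.le]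
  simp [Real.dist_eq, sq_abs]

/-- The equation of a circle through `a` and `b` in the coordinates adapted to `a` and `b`. -/
lemma mem_sphere_iff_coord {o a b : E2} {ρ : ℝ} (hρ : 0 < ρ) (hab : a ≠ b)
    (ha : a ∈ sphere o ρ) (hb : b ∈ sphere o ρ) (x : E2) :
    x ∈ sphere o ρ ↔ alongCoord a b x ^ 2 + acrossCoord a b x ^ 2 - alongCoord a b x
      - 2 * acrossCoord a b o * acrossCoord a b x = 0 := by
  have hD := sq_add_sq_ne_zero_of_ne hab
  rw [mem_sphere_iff_sq hρ] at ha hb ⊢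
  have h0 := coord_zero_eq hab x
  have h1 := coord_one_eq hab x
  have k0 := coord_zero_eq hab o
  have k1 := coord_one_eq hab o
  generalize alongCoord a b x = α at *
  generalize acrossCoord a b x = β at *
  generalize alongCoord a b o = ξ at *
  generalize acrossCoord a b o = η at *
  rw [k0, k1] at ha hb ⊢
  rw [h0, h1]
  have hξ : ξ = 1 / 2 := by
    apply mul_left_cancel₀ hD
    linear_combination (ha - hb) / 2
  subst hξ
  rw [← ha]
  constructor
  · intro h
    apply (mul_eq_zero_iff_left hD).1
    linear_combination h
  · intro h
    linear_combination ((b 0 - a 0) ^ 2 + (b 1 - a 1) ^ 2) * h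

/-- The chord map through `p` multiplies out to a constant in the parameter `secantParam`. -/
lemma ChordMap.secantParam_mul {o a b p : E2} {ρ : ℝ} {I : E2 → E2} (hI : ChordMap o ρ p I)
    (hρ : 0 < ρ) (hab : a ≠ b) (ha : a ∈ sphere o ρ) (hb : b ∈ sphere o ρ)
    (hp : p ∉ sphere o ρ) {t : ℝ} (hpt : p = AffineMap.lineMap a b t)
    {x : E2} (hx : x ∈ sphere o ρ) (hBx : acrossCoord a b x ≠ 0) :
    I x ∈ sphere o ρ ∧ acrossCoord a b (I x) ≠ 0 ∧
      secantParam o a b x * secantParam o a b (I x) * (t - 1) =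
        (1 + 4 * acrossCoord a b o ^ 2) * t := by
  obtain ⟨hyC, hyl, huniq⟩ := hI x hx
  refine ⟨hyC, ?_⟩
  obtain ⟨c, hc⟩ := mem_affineSpan_pair_iff_exists_lineMap_eq.1 hyl
  have hAp : alongCoord a b p = t := by
    rw [hpt, alongCoord_lineMap, alongCoord_left, alongCoord_right hab]; ring
  have hBp : acrossCoord a b p = 0 := by
    rw [hpt, acrossCoord_lineMap, acrossCoord_left, acrossCoord_right]; ring
  have hAc := alongCoord_lineMap a b x p c
  have hBc := acrossCoord_lineMap a b x p c
  have hc1 : c ≠ 1 := by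
    rintro rfl
    rw [AffineMap.lineMap_apply_one] at hc
    exact hp (hc ▸ hyC)
  have hQ : (t - alongCoord a b x) ^ 2 + acrossCoord a b x ^ 2 ≠ 0 := by positivity
  have hxeq := (mem_sphere_iff_coord hρ hab ha hb x).1 hx
  have hyeq := (mem_sphere_iff_coord hρ hab ha hb _).1 hyC
  -- the parameter on the line `xp` of the second intersection
  obtain ⟨m, hm⟩ : ∃ m : ℝ, m * ((t - alongCoord a b x) ^ 2 + acrossCoord a b x ^ 2) =
      -((2 * alongCoord a b x - 1) * (t - alongCoord a b x)
        - 2 * (acrossCoord a b x - acrossCoord a b o) * acrossCoord a b x) :=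
    ⟨_, div_mul_cancel₀ _ hQ⟩
  have hAm := alongCoord_lineMap a b x p m
  have hBm := acrossCoord_lineMap a b x p m
  have hmC : AffineMap.lineMap x p m ∈ sphere o ρ := by
    rw [mem_sphere_iff_coord hρ hab ha hb, hAm, hBm, hAp, hBp]
    linear_combination hxeq + m * hm
  have hcm : c = m := by
    rw [← hc, hAc, hBc, hAp, hBp] at hyeq
    have h0 : c * (c - m) = 0 := by
      apply (mul_eq_zero_iff_right hQ).1
      linear_combination hyeq - hxeq - c * hm
    rcases mul_eq_zero.1 h0 with h0 | h0
    · have hIx : I x = x := by rw [← hc, h0, AffineMap.lineMap_apply_zero]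
      have hmx : AffineMap.lineMap x p m = x := by
        rcases huniq _ hmC (AffineMap.lineMap_mem_affineSpan_pair _ _ _) with h | h
        · exact h
        · rw [h, hIx]
      rw [hmx, hBp] at hBm
      have : m * acrossCoord a b x = 0 := by linear_combination hBm
      rw [h0, (mul_eq_zero_iff_right hBx).1 this]
    · linarith
  subst hcm
  have hBy : acrossCoord a b (I x) = acrossCoord a b x * (1 - c) := by
    rw [← hc, hBc, hBp]; ring
  have hAy : alongCoord a b (I x) = alongCoord a b x + c * (t - alongCoord a b x) := by
    rw [← hc, hAc, hAp]
  have hc1' : 1 - c ≠ 0 := sub_ne_zero.2 hc1.symm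
  refine ⟨hBy ▸ mul_ne_zero hBx hc1', ?_⟩
  rw [secantParam, secantParam, hAy, hBy]
  generalize alongCoord a b x = α at *
  generalize acrossCoord a b x = β at *
  generalize acrossCoord a b o = η at *
  have hQc : c * ((t - α) ^ 2 + β ^ 2) = t - 2 * α * t + α + 2 * η * β := by
    linear_combination hm + 2 * hxeq
  have hQc' : (1 - c) * ((t - α) ^ 2 + β ^ 2) = t * (t - 1) := by
    linear_combination hxeq - hQc
  have key : (α + 2 * η * β) * (α + c * (t - α) + 2 * η * (β * (1 - c))) * (t - 1) =
      (1 + 4 * η ^ 2) * t * (β * (β * (1 - c))) := by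
    apply mul_left_cancel₀ hQ
    linear_combination (α + 2 * η * β) * (t - 1) * ((α + 2 * η * β) * hQc' + t * hQc)
      - (1 + 4 * η ^ 2) * t * β ^ 2 * hQc' - t ^ 2 * (t - 1) * hxeq
  field_simp
  linear_combination key

/-- The parameter `secantParam` is injective on the circle away from `a` and `b`. -/
lemma eq_of_secantParam_eq {o a b x y : E2} {ρ : ℝ} (hρ : 0 < ρ) (hab : a ≠ b)
    (ha : a ∈ sphere o ρ) (hb : b ∈ sphere o ρ) (hx : x ∈ sphere o ρ) (hy : y ∈ sphere o ρ)
    (hBx : acrossCoord a b x ≠ 0) (hBy : acrossCoord a b y ≠ 0)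
    (h : secantParam o a b x = secantParam o a b y) : x = y := by
  rw [mem_sphere_iff_coord hρ hab ha hb] at hx hy
  have hm : alongCoord a b x / acrossCoord a b x = alongCoord a b y / acrossCoord a b y :=
    add_right_cancel h
  obtain ⟨m, hmx⟩ : ∃ m, m = alongCoord a b x / acrossCoord a b x := ⟨_, rfl⟩
  have hmy := hmx.trans hm
  rw [eq_div_iff hBx] at hmx
  rw [eq_div_iff hBy] at hmy
  rw [← hmx] at hx
  rw [← hmy] at hy
  have hm0 : m ^ 2 + 1 ≠ 0 := by positivity
  have hB : acrossCoord a b x = acrossCoord a b y := by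
    apply mul_left_cancel₀ hm0
    apply mul_left_cancel₀ hBx
    apply mul_left_cancel₀ hBy
    linear_combination acrossCoord a b y * hx - acrossCoord a b x * hy
  exact eq_of_coord_eq hab (by rw [← hmx, ← hmy, hB]) hB

/-- The chord map through a point of the line `ab` sends `a` to `b`. -/
lemma ChordMap.apply_of_mem_line {o a b p : E2} {ρ : ℝ} {I : E2 → E2} (hI : ChordMap o ρ p I)
    (hab : a ≠ b) (ha : a ∈ sphere o ρ) (hb : b ∈ sphere o ρ) (hp : p ∉ sphere o ρ)
    (hpl : p ∈ affineSpan ℝ ({a, b} : Set E2)) : I a = b := by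
  obtain ⟨t, ht⟩ := mem_affineSpan_pair_iff_exists_lineMap_eq.1 hpl
  have ht0 : t ≠ 0 := by
    rintro rfl
    rw [AffineMap.lineMap_apply_zero] at ht
    exact hp (ht ▸ ha)
  have hbl : b ∈ affineSpan ℝ ({a, p} : Set E2) := by
    rw [mem_affineSpan_pair_iff_exists_lineMap_eq]
    refine ⟨t⁻¹, ?_⟩
    rw [← ht, AffineMap.lineMap_apply, AffineMap.lineMap_vsub_left, smul_smul,
      inv_mul_cancel₀ ht0, one_smul, vsub_vadd]
  rcases (hI a ha).2.2 b hb hbl with h | h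
  · exact absurd h.symm hab
  · exact h.symm

/-- A point of a circle on the line through two points `a, b` of the circle is `a` or `b`. -/
lemma eq_or_eq_of_acrossCoord_eq_zero {o a b x : E2} {ρ : ℝ} (hρ : 0 < ρ) (hab : a ≠ b)
    (ha : a ∈ sphere o ρ) (hb : b ∈ sphere o ρ) (hx : x ∈ sphere o ρ)
    (hBx : acrossCoord a b x = 0) : x = a ∨ x = b := by
  rw [mem_sphere_iff_coord hρ hab ha hb, hBx] at hx
  have h : alongCoord a b x * (alongCoord a b x - 1) = 0 := by linear_combination hx
  rcases mul_eq_zero.1 h with h | h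
  · exact Or.inl (eq_of_coord_eq hab (by rw [h, alongCoord_left]) (by rw [hBx, acrossCoord_left]))
  · exact Or.inr (eq_of_coord_eq hab (by rw [alongCoord_right hab]; linarith)
      (by rw [hBx, acrossCoord_right]))

/-- `ChordMap.secantParam_mul` in terms of a parametrization of the secant line. -/
lemma ChordMap.secantParam_mul_eq {o a b p o₀ v : E2} {ρ : ℝ} {I : E2 → E2}
    (hI : ChordMap o ρ p I) (hρ : 0 < ρ) (hab : a ≠ b) (ha : a ∈ sphere o ρ)
    (hb : b ∈ sphere o ρ) (hp : p ∉ sphere o ρ) {ta tb tp : ℝ} (hta : a = o₀ + ta • v)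
    (htb : b = o₀ + tb • v) (htp : p = o₀ + tp • v)
    {x : E2} (hx : x ∈ sphere o ρ) (hBx : acrossCoord a b x ≠ 0) :
    I x ∈ sphere o ρ ∧ acrossCoord a b (I x) ≠ 0 ∧
      secantParam o a b x * secantParam o a b (I x) * (tb - tp) =
        (1 + 4 * acrossCoord a b o ^ 2) * (ta - tp) := by
  have hd : tb - ta ≠ 0 := by
    intro h
    rw [sub_eq_zero] at h
    exact hab (by rw [hta, htb, h])
  have hpt : p = AffineMap.lineMap a b ((tp - ta) / (tb - ta)) := by
    rw [AffineMap.lineMap_apply, vsub_eq_sub, vadd_eq_add, hta, htb, htp, add_sub_add_left_eq_sub,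
      ← sub_smul, smul_smul, div_mul_cancel₀ _ hd, sub_smul]
    abel
  obtain ⟨h1, h2, h3⟩ := hI.secantParam_mul hρ hab ha hb hp hpt hx hBx
  refine ⟨h1, h2, ?_⟩
  have e : (tp - ta) / (tb - ta) * (tb - ta) = tp - ta := div_mul_cancel₀ _ hd
  linear_combination -(tb - ta) * h3 +
    (secantParam o a b x * secantParam o a b (I x) - (1 + 4 * acrossCoord a b o ^ 2)) * e

/-- Converse of the projective butterfly theorem, secant case: if the line through the
points `a, b` of the circle carries points `p, q, r, s` (not on the circle) with
`cr(a,b;p,q) = cr(a,b;s,r)`, then `I_s ∘ I_r ∘ I_q ∘ I_p` is the identity on the circle;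
in particular every point of the circle starts an inscribed quadrilateral whose sides pass
consecutively through `p, q, r, s`. -/
theorem projective_butterfly_secant_converse
    (o : E2) (ρ : ℝ) (hρ : 0 < ρ)
    (a b : E2) (hab : a ≠ b)
    (haC : a ∈ sphere o ρ) (hbC : b ∈ sphere o ρ)
    (p q r s : E2)
    (hpl : p ∈ affineSpan ℝ ({a, b} : Set E2))
    (hql : q ∈ affineSpan ℝ ({a, b} : Set E2))
    (hrl : r ∈ affineSpan ℝ ({a, b} : Set E2))
    (hsl : s ∈ affineSpan ℝ ({a, b} : Set E2))
    (hpC : p ∉ sphere o ρ) (hqC : q ∉ sphere o ρ)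
    (hrC : r ∉ sphere o ρ) (hsC : s ∉ sphere o ρ)
    -- a parametrization of the line through `a` and `b`
    (o₀ v : E2) (hv : v ≠ 0)
    (ta tb tp tq tr ts : ℝ)
    (hta : a = o₀ + ta • v) (htb : b = o₀ + tb • v)
    (htp : p = o₀ + tp • v) (htq : q = o₀ + tq • v)
    (htr : r = o₀ + tr • v) (hts : s = o₀ + ts • v)
    -- the cross-ratio condition
    (hcr : crossRatio ta tb tp tq = crossRatio ta tb ts tr)
    (Ip Iq Ir Is : E2 → E2)
    (hIp : ChordMap o ρ p Ip) (hIq : ChordMap o ρ q Iq)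
    (hIr : ChordMap o ρ r Ir) (hIs : ChordMap o ρ s Is) :
    ∀ x ∈ sphere o ρ, Is (Ir (Iq (Ip x))) = x := by
  intro x hx
  by_cases hBx : acrossCoord a b x = 0
  · have swap : ∀ {w : E2} {I : E2 → E2}, ChordMap o ρ w I → w ∉ sphere o ρ →
        w ∈ affineSpan ℝ ({a, b} : Set E2) → I a = b ∧ I b = a := fun hI hw hwl =>
      ⟨hI.apply_of_mem_line hab haC hbC hw hwl,
        hI.apply_of_mem_line hab.symm hbC haC hw (Set.pair_comm a b ▸ hwl)⟩
    obtain ⟨p1, p2⟩ := swap hIp hpC hpl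
    obtain ⟨q1, q2⟩ := swap hIq hqC hql
    obtain ⟨r1, r2⟩ := swap hIr hrC hrl
    obtain ⟨s1, s2⟩ := swap hIs hsC hsl
    rcases eq_or_eq_of_acrossCoord_eq_zero hρ hab haC hbC hx hBx with rfl | rfl
    · rw [p1, q2, r1, s2]
    · rw [p2, q1, r2, s1]
  · obtain ⟨c1, n1, e1⟩ := hIp.secantParam_mul_eq hρ hab haC hbC hpC hta htb htp hx hBx
    obtain ⟨c2, n2, e2⟩ := hIq.secantParam_mul_eq hρ hab haC hbC hqC hta htb htq c1 n1
    obtain ⟨c3, n3, e3⟩ := hIr.secantParam_mul_eq hρ hab haC hbC hrC hta htb htr c2 n2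
    obtain ⟨c4, n4, e4⟩ := hIs.secantParam_mul_eq hρ hab haC hbC hsC hta htb hts c3 n3
    refine eq_of_secantParam_eq hρ hab haC hbC c4 hx n4 hBx ?_
    have hne : ∀ {w : E2} {t : ℝ}, w = o₀ + t • v → w ∉ sphere o ρ →
        ta - t ≠ 0 ∧ tb - t ≠ 0 := by
      intro w t hw hwC
      constructor
      · intro h
        exact hwC (by rw [hw, ← sub_eq_zero.1 h, ← hta]; exact haC)
      · intro h
        exact hwC (by rw [hw, ← sub_eq_zero.1 h, ← htb]; exact hbC)
    obtain ⟨pa, pb⟩ := hne htp hpC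
    obtain ⟨qa, qb⟩ := hne htq hqC
    obtain ⟨ra, rb⟩ := hne htr hrC
    obtain ⟨sa, sb⟩ := hne hts hsC
    have hM : 1 + 4 * acrossCoord a b o ^ 2 ≠ 0 := by positivity
    rw [crossRatio, crossRatio, div_mul_div_comm, div_mul_div_comm,
      div_eq_div_iff (mul_ne_zero pb qa) (mul_ne_zero sb ra)] at hcr
    generalize secantParam o a b (Is (Ir (Iq (Ip x)))) = z4 at *
    generalize secantParam o a b (Ir (Iq (Ip x))) = z3 at *
    generalize secantParam o a b (Iq (Ip x)) = z2 at *
    generalize secantParam o a b (Ip x) = z1 at *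
    generalize secantParam o a b x = z0 at *
    generalize 1 + 4 * acrossCoord a b o ^ 2 = M at *
    have hz12 : z1 * z2 ≠ 0 := fun h => mul_ne_zero hM qa (by rw [← e2, h, zero_mul])
    have hz23 : z2 * z3 ≠ 0 := fun h => mul_ne_zero hM ra (by rw [← e3, h, zero_mul])
    rw [← eq_div_iff pb] at e1
    rw [← eq_div_iff qb] at e2
    rw [← eq_div_iff rb] at e3
    rw [← eq_div_iff sb] at e4
    apply mul_left_cancel₀ (mul_ne_zero (left_ne_zero_of_mul hz12) hz23)
    have key : (z1 * z2) * (z3 * z4) = (z0 * z1) * (z2 * z3) := by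
      rw [e1, e2, e3, e4]
      field_simp
      linear_combination -hcr
    linear_combination key
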